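/- There exists a function C₀ of one real variable such that: for every F ∈ C⁰(T⁵) satisfying the normalization (N) ∫_{[0,1]⁵}(e^F − 1) dx = 0, and every φ ∈ C²(T⁵) with ∫_{[−1/2,1/2]⁵} φ = 0 solving equation (★), one has ‖φ‖_{C⁰} ≤ C₀(‖F‖_{C⁰}). -/

import Mathlib

open MeasureTheory

/-- Partial derivative in the `i`-th coordinate direction. -/
noncomputable def pd {n : ℕ} (i : Fin n) (f : (Fin n → ℝ) → ℝ) : (Fin n → ℝ) → ℝ :=
  fun x => fderiv ℝ f x (Pi.single i 1)

/-- Second partial derivative `∂²f/∂x^i∂x^j`. -/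
noncomputable def pd2 {n : ℕ} (i j : Fin n) (f : (Fin n → ℝ) → ℝ) : (Fin n → ℝ) → ℝ :=
  pd i (pd j f)

/-- A function on `ℝⁿ` that is `1`-periodic in every coordinate, i.e. a function on `Tⁿ`. -/
def PeriodicPi {n : ℕ} (f : (Fin n → ℝ) → ℝ) : Prop :=
  ∀ x : Fin n → ℝ, ∀ i : Fin n, f (x + Pi.single i 1) = f x

/-- The Euclidean Laplacian. -/
noncomputable def lap {n : ℕ} (f : (Fin n → ℝ) → ℝ) : (Fin n → ℝ) → ℝ :=
  fun x => ∑ i, pd2 i i f x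

/-- Equation (★): the reduction of the quaternionic Monge–Ampère equation to `T⁵`. -/
def EqStar (F φ : (Fin 5 → ℝ) → ℝ) : Prop :=
  ∀ x : Fin 5 → ℝ,
    (pd2 0 0 φ x + pd2 1 1 φ x + pd2 2 2 φ x + pd2 3 3 φ x + 1) * (pd2 4 4 φ x + 1)
      - (pd2 0 4 φ x) ^ 2 - (pd2 1 4 φ x) ^ 2 - (pd2 2 4 φ x) ^ 2 - (pd2 3 4 φ x) ^ 2
      = Real.exp (F x)

/-- Iterated partial derivative `∂^I f` for a multi-index `I`. -/
noncomputable def pdI {n : ℕ} (I : Fin n → ℕ) (f : (Fin n → ℝ) → ℝ) : (Fin n → ℝ) → ℝ :=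
  (List.finRange n).foldr (fun i g => (pd i)^[I i] g) f

/-- The `Cᵏ`-norm `max_{|I| ≤ k} sup_x |∂^I f(x)|`. -/
noncomputable def CNorm {n : ℕ} (k : ℕ) (f : (Fin n → ℝ) → ℝ) : ℝ :=
  ⨆ I : Fin n → ℕ, ⨆ _ : (∑ i, I i) ≤ k, ⨆ x : Fin n → ℝ, |pdI I f x|


open Filter Topology Set

theorem nonneg_of_isLocalMin_of_hasDerivAt {g g' : ℝ → ℝ} {c a : ℝ}
    (hg : ∀ t, HasDerivAt g (g' t) t) (hg' : HasDerivAt g' c a) (hmin : IsLocalMin g a) :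
    0 ≤ c := by
  by_contra! hc
  have hderiv : deriv g = g' := funext fun t => (hg t).deriv
  have h0 : g' a = 0 := hmin.hasDerivAt_eq_zero (hg a)
  have hmax : IsLocalMax g a := isLocalMax_of_deriv_deriv_neg
    (by rw [hderiv, hg'.deriv]; exact hc) (by rw [hderiv, h0]) (hg a).continuousAt
  have hconst : g =ᶠ[𝓝 a] fun _ => g a := by
    filter_upwards [hmin, hmax] with t h1 h2 using le_antisymm h2 h1
  have h1 : deriv (deriv g) a = 0 := by
    rw [(hconst.deriv).deriv_eq]; simp
  rw [hderiv, hg'.deriv] at h1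
  exact hc.ne h1

section Calculus

variable {n : ℕ} {u : (Fin n → ℝ) → ℝ}

theorem hasFDerivAt_fderiv_apply (hu : ContDiff ℝ 2 u) (h x : Fin n → ℝ) :
    HasFDerivAt (fun y => fderiv ℝ u y h) ((fderiv ℝ (fderiv ℝ u) x).flip h) x := by
  have h1 : HasFDerivAt (fderiv ℝ u) (fderiv ℝ (fderiv ℝ u) x) x :=
    ((hu.fderiv_right (m := 1) (by norm_num)).differentiable (by norm_num) x).hasFDerivAt
  exact (h1.clm_apply (hasFDerivAt_const h x)).congr_fderiv (by simp)

theorem hasFDerivAt_pd (hu : ContDiff ℝ 2 u) (i : Fin n) (x : Fin n → ℝ) :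
    HasFDerivAt (pd i u) ((fderiv ℝ (fderiv ℝ u) x).flip (Pi.single i 1)) x :=
  hasFDerivAt_fderiv_apply hu (Pi.single i 1) x

theorem pd2_eq (hu : ContDiff ℝ 2 u) (i j : Fin n) (x : Fin n → ℝ) :
    pd2 i j u x = fderiv ℝ (fderiv ℝ u) x (Pi.single i 1) (Pi.single j 1) := by
  rw [pd2, pd, (hasFDerivAt_pd hu j x).fderiv]; rfl

theorem fderiv_fderiv_comm (hu : ContDiff ℝ 2 u) (x a b : Fin n → ℝ) :
    fderiv ℝ (fderiv ℝ u) x a b = fderiv ℝ (fderiv ℝ u) x b a :=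
  (hu.contDiffAt.isSymmSndFDerivAt (by simp)) a b

theorem pd2_comm (hu : ContDiff ℝ 2 u) (i j : Fin n) (x : Fin n → ℝ) :
    pd2 i j u x = pd2 j i u x := by
  rw [pd2_eq hu, pd2_eq hu, fderiv_fderiv_comm hu]

theorem contDiff_pd (hu : ContDiff ℝ 2 u) (i : Fin n) : ContDiff ℝ 1 (pd i u) :=
  (hu.fderiv_right (m := 1) (by norm_num)).clm_apply contDiff_const

theorem continuous_pd2 (hu : ContDiff ℝ 2 u) (i j : Fin n) : Continuous (pd2 i j u) :=
  ((contDiff_pd hu j).continuous_fderiv (by norm_num)).clm_apply continuous_const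

theorem pd2_neg (i j : Fin n) (x : Fin n → ℝ) :
    pd2 i j (fun y => -u y) x = -pd2 i j u x := by
  have h : pd j (fun y => -u y) = fun y => -pd j u y := by
    funext y; simp [pd, fderiv_fun_neg]
  rw [pd2, h, pd2, pd, pd, fderiv_fun_neg]; rfl

/-- The Hessian of `u` at `x` is bounded below by `-η` as a quadratic form. -/
def HessGE (u : (Fin n → ℝ) → ℝ) (η : ℝ) (x : Fin n → ℝ) : Prop :=
  ∀ h : Fin n → ℝ, 0 ≤ fderiv ℝ (fderiv ℝ u) x h h + η * (h ⬝ᵥ h)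

theorem HessGE.sq_le {η : ℝ} {x : Fin n → ℝ} (hu : ContDiff ℝ 2 u) (H : HessGE u η x)
    (i j : Fin n) :
    (pd2 i j u x + η * if i = j then 1 else 0) ^ 2 ≤
      (pd2 i i u x + η) * (pd2 j j u x + η) := by
  have key : ∀ s : ℝ, 0 ≤ (pd2 i i u x + η) * (s * s)
      + 2 * (pd2 i j u x + η * if i = j then 1 else 0) * s + (pd2 j j u x + η) := by
    intro s
    have h := H (s • Pi.single i 1 + Pi.single j 1)
    simp only [map_add, map_smul, add_apply, smul_apply,
      add_dotProduct, dotProduct_add, smul_dotProduct, dotProduct_smul, smul_eq_mul,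
      single_dotProduct, Pi.single_apply, ← pd2_eq hu, pd2_comm hu j i, one_mul, if_true] at h
    by_cases hij : i = j
    · subst hij; simp only [if_true] at h ⊢; nlinarith
    · simp only [hij, Ne.symm hij, if_false] at h ⊢; nlinarith
  have := discrim_le_zero key
  rw [discrim] at this
  linarith

theorem HessGE.diag_nonneg {η : ℝ} {x : Fin n → ℝ} (hu : ContDiff ℝ 2 u) (H : HessGE u η x)
    (i : Fin n) : 0 ≤ pd2 i i u x + η := by
  have h := H (Pi.single i 1)
  simpa [← pd2_eq hu] using h

theorem HessGE.abs_le {η K : ℝ} {x : Fin n → ℝ} (hu : ContDiff ℝ 2 u) (H : HessGE u η x)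
    (hK : ∑ i, (pd2 i i u x + η) ≤ K) (i j : Fin n) :
    |pd2 i j u x + η * if i = j then 1 else 0| ≤ K := by
  have hd : ∀ k, pd2 k k u x + η ≤ K := fun k =>
    (Finset.single_le_sum (f := fun k => pd2 k k u x + η)
      (fun k _ => H.diag_nonneg hu k) (Finset.mem_univ k)).trans hK
  have hK0 : 0 ≤ K := (H.diag_nonneg hu i).trans (hd i)
  apply abs_le_of_sq_le_sq _ hK0
  calc _ ≤ _ := H.sq_le hu i j
    _ ≤ K * K := mul_le_mul (hd i) (hd j) (H.diag_nonneg hu j) hK0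
    _ = K ^ 2 := by ring

/-- First and second order conditions at a local minimum of a quadratic perturbation of `u`. -/
theorem pd_eq_and_hessGE_of_isLocalMin (hu : ContDiff ℝ 2 u) {η : ℝ} {p x₀ x : Fin n → ℝ}
    (hmin : IsLocalMin
      (fun y => u y + η / 2 * ((y - x₀) ⬝ᵥ (y - x₀)) - p ⬝ᵥ (y - x₀)) x) :
    (∀ i, pd i u x + η * (x i - x₀ i) = p i) ∧ HessGE u η x := by
  have hline : ∀ h : Fin n → ℝ, ∀ t : ℝ, HasDerivAt (fun t : ℝ => x + t • h) h t := fun h t => by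
    simpa using ((hasDerivAt_id t).smul_const h).const_add x
  have hg : ∀ h : Fin n → ℝ, ∀ t : ℝ, HasDerivAt
      (fun t : ℝ => u (x + t • h) + η / 2 * ((x + t • h - x₀) ⬝ᵥ (x + t • h - x₀))
        - p ⬝ᵥ (x + t • h - x₀))
      (fderiv ℝ u (x + t • h) h + η * (h ⬝ᵥ (x - x₀) + t * (h ⬝ᵥ h)) - p ⬝ᵥ h) t := by
    intro h t
    have h1 := ((hu.differentiable (by norm_num)) (x + t • h)).hasFDerivAt.comp_hasDerivAt t
      (hline h t)
    have h2 : HasDerivAt (fun t : ℝ => (x - x₀) ⬝ᵥ (x - x₀) + 2 * t * (h ⬝ᵥ (x - x₀))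
        + t * t * (h ⬝ᵥ h)) (2 * (h ⬝ᵥ (x - x₀)) + 2 * t * (h ⬝ᵥ h)) t := by
      have e1 := ((hasDerivAt_id t).const_mul 2).mul_const (h ⬝ᵥ (x - x₀))
      have e2 := ((hasDerivAt_id t).mul (hasDerivAt_id t)).mul_const (h ⬝ᵥ h)
      exact ((e1.const_add ((x - x₀) ⬝ᵥ (x - x₀))).add e2).congr_deriv
        (by simp only [id]; ring)
    have h3 : HasDerivAt (fun t : ℝ => p ⬝ᵥ (x - x₀) + t * (p ⬝ᵥ h)) (p ⬝ᵥ h) t := by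
      simpa using ((hasDerivAt_id t).mul_const (p ⬝ᵥ h)).const_add (p ⬝ᵥ (x - x₀))
    have e : (fun t : ℝ => u (x + t • h) + η / 2 * ((x + t • h - x₀) ⬝ᵥ (x + t • h - x₀))
        - p ⬝ᵥ (x + t • h - x₀)) = fun t : ℝ => u (x + t • h) + η / 2 * ((x - x₀) ⬝ᵥ (x - x₀)
          + 2 * t * (h ⬝ᵥ (x - x₀)) + t * t * (h ⬝ᵥ h)) - (p ⬝ᵥ (x - x₀) + t * (p ⬝ᵥ h)) := by
      funext t
      have : x + t • h - x₀ = (x - x₀) + t • h := by abel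
      rw [this]
      generalize x - x₀ = y
      simp only [dotProduct_add, add_dotProduct, dotProduct_smul, smul_dotProduct, smul_eq_mul,
        dotProduct_comm y h]
      ring
    rw [e]
    exact ((h1.add (h2.const_mul (η / 2))).sub h3).congr_deriv (by ring)
  have hg' : ∀ h : Fin n → ℝ, HasDerivAt
      (fun t : ℝ => fderiv ℝ u (x + t • h) h + η * (h ⬝ᵥ (x - x₀) + t * (h ⬝ᵥ h)) - p ⬝ᵥ h)
      (fderiv ℝ (fderiv ℝ u) x h h + η * (h ⬝ᵥ h)) 0 := by
    intro h
    have h1 : HasDerivAt (fun t : ℝ => fderiv ℝ u (x + t • h) h)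
        (fderiv ℝ (fderiv ℝ u) x h h) 0 := by
      have h0 : HasDerivAt (fun t : ℝ => fderiv ℝ u (x + t • h) h)
          (fderiv ℝ (fderiv ℝ u) (x + (0 : ℝ) • h) h h) 0 :=
        HasFDerivAt.comp_hasDerivAt (l := fun y => fderiv ℝ u y h)
          (l' := (fderiv ℝ (fderiv ℝ u) (x + (0 : ℝ) • h)).flip h) 0
          (hasFDerivAt_fderiv_apply hu h (x + (0 : ℝ) • h)) (hline h 0)
      rwa [zero_smul, add_zero] at h0
    have h2 : HasDerivAt (fun t : ℝ => η * (h ⬝ᵥ (x - x₀) + t * (h ⬝ᵥ h))) (η * (h ⬝ᵥ h)) 0 := by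
      simpa using
        (((hasDerivAt_id (0 : ℝ)).mul_const (h ⬝ᵥ h)).const_add (h ⬝ᵥ (x - x₀))).const_mul η
    exact ((h1.add h2).sub_const (p ⬝ᵥ h)).congr_deriv (by simp)
  have hm : ∀ h : Fin n → ℝ, IsLocalMin
      (fun t : ℝ => u (x + t • h) + η / 2 * ((x + t • h - x₀) ⬝ᵥ (x + t • h - x₀))
        - p ⬝ᵥ (x + t • h - x₀)) 0 := by
    intro h
    have hc : Tendsto (fun t : ℝ => x + t • h) (𝓝 0) (𝓝 x) := by
      simpa using (hline h 0).continuousAt.tendsto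
    have := hc.eventually hmin
    simpa [IsLocalMin, IsMinFilter] using this
  refine ⟨fun i => ?_, fun h => (nonneg_of_isLocalMin_of_hasDerivAt (hg h) (hg' h) (hm h))⟩
  have := (hm (Pi.single i 1)).hasDerivAt_eq_zero (hg (Pi.single i 1) 0)
  simp at this
  rw [pd]
  linarith

end Calculus


section ContactSet

variable {n : ℕ}

theorem sq_norm_le_dotProduct (y : Fin n → ℝ) : ‖y‖ ^ 2 ≤ y ⬝ᵥ y := by
  have h0 : 0 ≤ y ⬝ᵥ y := Finset.sum_nonneg fun i _ => mul_self_nonneg (y i)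
  have : ‖y‖ ≤ √(y ⬝ᵥ y) := by
    refine (pi_norm_le_iff_of_nonneg (Real.sqrt_nonneg _)).2 fun i => ?_
    rw [Real.norm_eq_abs]
    refine Real.abs_le_sqrt ?_
    rw [sq]
    exact Finset.single_le_sum (f := fun i => y i * y i) (fun i _ => mul_self_nonneg (y i))
      (Finset.mem_univ i)
  calc ‖y‖ ^ 2 ≤ √(y ⬝ᵥ y) ^ 2 := by gcongr
    _ = y ⬝ᵥ y := Real.sq_sqrt h0

theorem dotProduct_le_card_mul_norm (p y : Fin n → ℝ) : p ⬝ᵥ y ≤ n * (‖p‖ * ‖y‖) := by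
  calc p ⬝ᵥ y ≤ ∑ _i : Fin n, ‖p‖ * ‖y‖ := Finset.sum_le_sum fun i _ => by
        calc p i * y i ≤ ‖p i * y i‖ := Real.le_norm_self _
          _ = ‖p i‖ * ‖y i‖ := norm_mul _ _
          _ ≤ ‖p‖ * ‖y‖ := by gcongr <;> exact norm_le_pi_norm _ i
    _ = n * (‖p‖ * ‖y‖) := by simp

/-- Every small slope `p` is attained by the gradient of `u + η|x - x₀|²/2` at a contact point. -/
theorem exists_contact_point {u : (Fin n → ℝ) → ℝ} (hu : ContDiff ℝ 2 u) {η : ℝ} (hη : 0 < η)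
    {x₀ p : Fin n → ℝ} (hmin : ∀ x, u x₀ ≤ u x) (hp : ‖p‖ < η / (4 * (n + 1))) :
    ∃ x ∈ Metric.closedBall x₀ (1 / 2), u x ≤ u x₀ + η / 8 ∧ HessGE u η x ∧
      ∀ i, pd i u x + η * (x i - x₀ i) = p i := by
  set w : (Fin n → ℝ) → ℝ :=
    fun y => u y + η / 2 * ((y - x₀) ⬝ᵥ (y - x₀)) - p ⬝ᵥ (y - x₀) with hw
  have hwc : Continuous w := by
    have := hu.continuous
    simp only [hw, dotProduct, Pi.sub_apply]
    fun_prop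
  obtain ⟨x, hx, hxmin⟩ := (isCompact_closedBall x₀ (1 / 2 : ℝ)).exists_isMinOn
    ⟨x₀, Metric.mem_closedBall_self (by norm_num)⟩ hwc.continuousOn
  have hle : w x ≤ u x₀ := by
    have := hxmin (Metric.mem_closedBall_self (by norm_num : (0 : ℝ) ≤ 1 / 2))
    simpa [hw] using this
  have hnorm : ‖x - x₀‖ ≤ 1 / 2 := by rwa [← dist_eq_norm]
  have hnp : n * ‖p‖ < η / 4 := by
    rw [lt_div_iff₀ (by positivity)] at hp
    nlinarith [norm_nonneg p]
  have hpx : p ⬝ᵥ (x - x₀) ≤ (n * ‖p‖) * ‖x - x₀‖ := by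
    simpa [mul_assoc] using dotProduct_le_card_mul_norm p (x - x₀)
  have hn0 : 0 ≤ n * ‖p‖ := by positivity
  have hsq := sq_norm_le_dotProduct (x - x₀)
  have hlt : ‖x - x₀‖ < 1 / 2 := by
    refine lt_of_le_of_ne hnorm fun h => ?_
    rw [h] at hpx hsq
    have := hmin x
    simp only [hw] at hle
    nlinarith
  have hloc : IsLocalMin w x := by
    filter_upwards [Metric.isOpen_ball.mem_nhds
      (show x ∈ Metric.ball x₀ (1 / 2) by rwa [Metric.mem_ball, dist_eq_norm])] with y hy
    exact hxmin (Metric.ball_subset_closedBall hy)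
  obtain ⟨h1, h2⟩ := pd_eq_and_hessGE_of_isLocalMin hu hloc
  refine ⟨x, hx, ?_, h2, h1⟩
  simp only [hw] at hle
  nlinarith [norm_nonneg (x - x₀), sq_nonneg ‖x - x₀‖]

/-- Alexandrov–Bakelman–Pucci type estimate: a `C²` function whose Laplacian is bounded wherever
its Hessian is bounded below has large sublevel sets near its minimum. -/
theorem volume_ball_le_mul_volume_sublevel {u : (Fin n → ℝ) → ℝ} (hu : ContDiff ℝ 2 u)
    {η K : ℝ} (hη : 0 < η) {x₀ : Fin n → ℝ} (hmin : ∀ x, u x₀ ≤ u x)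
    (hK : ∀ x, HessGE u η x → ∑ i, (pd2 i i u x + η) ≤ K) :
    volume (Metric.ball (0 : Fin n → ℝ) (η / (4 * (n + 1)))) ≤
      ENNReal.ofReal (n.factorial * K ^ n) *
        volume {x | x ∈ Metric.closedBall x₀ (1 / 2) ∧ u x ≤ u x₀ + η / 8} := by
  set P : Set (Fin n → ℝ) := {x | (x ∈ Metric.closedBall x₀ (1 / 2) ∧ u x ≤ u x₀ + η / 8) ∧
    ∀ i j, |pd2 i j u x + η * if i = j then 1 else 0| ≤ K} with hP
  have hPm : MeasurableSet P := by
    refine IsClosed.measurableSet ?_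
    have h1 : IsClosed {x | ∀ i j, |pd2 i j u x + η * if i = j then 1 else 0| ≤ K} := by
      rw [Set.ofPred_forall]
      refine isClosed_iInter fun i => ?_
      rw [Set.ofPred_forall]
      refine isClosed_iInter fun j => ?_
      exact isClosed_le (((continuous_pd2 hu i j).add continuous_const).abs) continuous_const
    exact (Metric.isClosed_closedBall.inter (isClosed_le hu.continuous continuous_const)).inter h1
  set G : (Fin n → ℝ) → (Fin n → ℝ) := fun x i => pd i u x + η * (x i - x₀ i) with hG
  set G' : (Fin n → ℝ) → (Fin n → ℝ) →L[ℝ] (Fin n → ℝ) := fun x =>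
    ContinuousLinearMap.pi fun i => (fderiv ℝ (fderiv ℝ u) x).flip (Pi.single i 1) +
      η • ContinuousLinearMap.proj i with hG'
  have hGd : ∀ x, HasFDerivAt G (G' x) x := fun x => by
    refine hasFDerivAt_pi.2 fun i => (hasFDerivAt_pd hu i x).add ?_
    exact (((ContinuousLinearMap.proj (R := ℝ) (φ := fun _ : Fin n => ℝ) i).hasFDerivAt
      (x := x)).sub_const (x₀ i)).const_mul η
  have hdet : ∀ x ∈ P, |(G' x).det| ≤ n.factorial * K ^ n := by
    intro x hx
    rw [ContinuousLinearMap.det, ← LinearMap.det_toMatrix']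
    have := Matrix.det_le (A := LinearMap.toMatrix' (G' x : (Fin n → ℝ) →ₗ[ℝ] (Fin n → ℝ)))
      (abv := AbsoluteValue.abs) (x := K) (fun i j => by
        have := hx.2 j i
        simp only [pd2_eq hu] at this
        simpa [LinearMap.toMatrix'_apply, hG', Pi.single_apply, eq_comm] using this)
    simpa using this
  have hsub : Metric.ball (0 : Fin n → ℝ) (η / (4 * (n + 1))) ⊆ G '' P := by
    intro p hp
    rw [mem_ball_zero_iff] at hp
    obtain ⟨x, hx, h1, h2, h3⟩ := exists_contact_point hu hη hmin hp
    exact ⟨x, ⟨⟨hx, h1⟩, h2.abs_le hu (hK x h2)⟩, funext h3⟩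
  calc volume (Metric.ball (0 : Fin n → ℝ) (η / (4 * (n + 1)))) ≤ volume (G '' P) :=
        measure_mono hsub
    _ ≤ ∫⁻ x in P, ENNReal.ofReal |(G' x).det| :=
        addHaar_image_le_lintegral_abs_det_fderiv volume hPm fun x _ =>
          (hGd x).hasFDerivWithinAt
    _ ≤ ∫⁻ _ in P, ENNReal.ofReal (n.factorial * K ^ n) :=
        setLIntegral_mono measurable_const fun x hx => ENNReal.ofReal_le_ofReal (hdet x hx)
    _ = ENNReal.ofReal (n.factorial * K ^ n) * volume P := setLIntegral_const _ _
    _ ≤ _ := by gcongr; exact fun x hx => hx.1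

end ContactSet


section Torus

variable {n : ℕ}

theorem PeriodicPi.add_mem_span {f : (Fin n → ℝ) → ℝ} (hf : PeriodicPi f) {g : Fin n → ℝ}
    (hg : g ∈ Submodule.span ℤ (range (Pi.basisFun ℝ (Fin n)))) (x : Fin n → ℝ) :
    f (x + g) = f x := by
  rw [← Submodule.mem_toAddSubgroup, Submodule.span_int_eq_addSubgroupClosure] at hg
  induction hg using AddSubgroup.closure_induction generalizing x with
  | mem y hy => obtain ⟨i, rfl⟩ := hy; simpa using hf x i
  | zero => simp
  | add y z _ _ h1 h2 => rw [← add_assoc, h2, h1]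
  | neg y _ h => rw [← h (x + -y), neg_add_cancel_right]

theorem PeriodicPi.exists_mem_Icc {f : (Fin n → ℝ) → ℝ} (hf : PeriodicPi f) (x : Fin n → ℝ) :
    ∃ y ∈ Icc (0 : Fin n → ℝ) 1, f y = f x := by
  set b := Pi.basisFun ℝ (Fin n)
  have hy := ZSpan.fract_mem_fundamentalDomain b x
  rw [ZSpan.fundamentalDomain_pi_basisFun] at hy
  refine ⟨ZSpan.fract b x, ⟨fun i => (hy i trivial).1, fun i => (hy i trivial).2.le⟩, ?_⟩
  rw [← hf.add_mem_span (ZSpan.floor b x).2, ZSpan.fract_apply, sub_add_cancel]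

theorem PeriodicPi.exists_forall_le {f : (Fin n → ℝ) → ℝ} (hf : PeriodicPi f)
    (hc : Continuous f) : ∃ x₀, ∀ x, f x₀ ≤ f x := by
  obtain ⟨x₀, -, h⟩ := (isCompact_Icc (a := (0 : Fin n → ℝ)) (b := 1)).exists_isMinOn
    (nonempty_Icc.2 zero_le_one) hc.continuousOn
  refine ⟨x₀, fun x => ?_⟩
  obtain ⟨y, hy, hyx⟩ := hf.exists_mem_Icc x
  exact hyx ▸ h hy

theorem PeriodicPi.neg {f : (Fin n → ℝ) → ℝ} (hf : PeriodicPi f) :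
    PeriodicPi fun x => -f x := fun x i => by simp only [hf x i]

theorem PeriodicPi.bddAbove_abs {f : (Fin n → ℝ) → ℝ} (hf : PeriodicPi f) (hc : Continuous f) :
    BddAbove (range fun x => |f x|) := by
  have h : PeriodicPi fun x => -|f x| := fun x i => by simp only [hf x i]
  obtain ⟨x₀, hx₀⟩ := h.exists_forall_le hc.abs.neg
  exact ⟨|f x₀|, forall_mem_range.2 fun x => neg_le_neg_iff.1 (hx₀ x)⟩

open scoped Pointwise in
theorem PeriodicPi.setIntegral_add_right {f : (Fin n → ℝ) → ℝ} (hf : PeriodicPi f)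
    (a : Fin n → ℝ) :
    ∫ x in Icc (0 : Fin n → ℝ) 1, f (x + a) = ∫ x in Icc (0 : Fin n → ℝ) 1, f x := by
  set b := Pi.basisFun ℝ (Fin n)
  have hae : (Icc (0 : Fin n → ℝ) 1 : Set _) =ᵐ[volume] ZSpan.fundamentalDomain b := by
    rw [ZSpan.fundamentalDomain_pi_basisFun]
    exact (Measure.univ_pi_Ico_ae_eq_Icc (f := (0 : Fin n → ℝ)) (g := 1)).symm
  rw [setIntegral_congr_set hae, setIntegral_congr_set hae]
  have hD := ZSpan.isAddFundamentalDomain' b (volume : Measure (Fin n → ℝ))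
  have : Countable (Submodule.span ℤ (range b)).toAddSubgroup :=
    inferInstanceAs (Countable (Submodule.span ℤ (range b)))
  have hper : ∀ (g : (Submodule.span ℤ (range b)).toAddSubgroup) (x : Fin n → ℝ), f (g +ᵥ x) = f x := by
    intro g x
    rw [AddSubgroup.vadd_def, vadd_eq_add, add_comm]
    exact hf.add_mem_span g.2 x
  rw [← (hD.vadd_of_comm a).setIntegral_eq hD hper]
  have := (measurePreserving_add_right volume a).setIntegral_preimage_emb
    (measurableEmbedding_addRight a) f (a +ᵥ ZSpan.fundamentalDomain b)
  rw [← this]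
  congr 2
  ext x
  simp [mem_vadd_set_iff_neg_vadd_mem, add_comm x a]

theorem PeriodicPi.setIntegral_Icc_add_one {f : (Fin n → ℝ) → ℝ} (hf : PeriodicPi f)
    (a : Fin n → ℝ) :
    ∫ x in Icc a (a + 1), f x = ∫ x in Icc (0 : Fin n → ℝ) 1, f x := by
  rw [← hf.setIntegral_add_right a]
  have := (measurePreserving_add_right volume a).setIntegral_preimage_emb
    (measurableEmbedding_addRight a) f (Icc a (a + 1))
  rw [← this]
  congr 2
  ext x
  simp [Set.mem_Icc, add_comm a 1]

theorem volume_real_unitCube : volume.real (Icc (0 : Fin n → ℝ) 1) = 1 := by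
  simp [Measure.real, Real.volume_Icc_pi]

theorem PeriodicPi.pd {f : (Fin n → ℝ) → ℝ} (hf : PeriodicPi f) (i : Fin n) :
    PeriodicPi (pd i f) := by
  intro x j
  have : (fun y => f (y + Pi.single j 1)) = f := funext fun y => hf y j
  rw [_root_.pd, ← fderiv_comp_add_right, this]; rfl

theorem integral_sum_pd_eq_zero {f : Fin n → (Fin n → ℝ) → ℝ} (hf : ∀ i, ContDiff ℝ 1 (f i))
    (hp : ∀ i, PeriodicPi (f i)) :
    ∫ x in Icc (0 : Fin n → ℝ) 1, ∑ i, pd i (f i) x = 0 := by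
  cases n with
  | zero => simp
  | succ n =>
    have := integral_divergence_of_hasFDerivAt_off_countable' (0 : Fin (n + 1) → ℝ) 1 zero_le_one
      f (fun i => fderiv ℝ (f i)) ∅ countable_empty (fun i => (hf i).continuous.continuousOn)
      (fun x _ i => ((hf i).differentiable (by norm_num) x).hasFDerivAt)
      (Continuous.integrableOn_Icc (continuous_finsetSum _ fun i _ =>
        ((hf i).continuous_fderiv (by norm_num)).clm_apply continuous_const))
    simp only [_root_.pd]
    rw [this]
    refine Finset.sum_eq_zero fun i _ => sub_eq_zero.2 ?_
    refine setIntegral_congr_fun measurableSet_Icc fun x _ => ?_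
    have h := hp i (i.insertNth 0 x) i
    have e : (i.insertNth (0 : ℝ) x + Pi.single i 1 : Fin (n + 1) → ℝ) = i.insertNth 1 x := by
      ext j
      refine Fin.succAboveCases i ?_ (fun j => ?_) j <;> simp
    rw [e] at h
    exact h

/-- Energy estimate for functions with Laplacian bounded below. -/
theorem integral_sq_pd_le {φ : (Fin n → ℝ) → ℝ} (hφ : ContDiff ℝ 2 φ) (hp : PeriodicPi φ)
    {m L : ℝ} (hm : ∀ x, m ≤ φ x) (hL : ∀ x, -L ≤ lap φ x)
    (h0 : ∫ x in Icc (0 : Fin n → ℝ) 1, φ x = 0) :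
    ∫ x in Icc (0 : Fin n → ℝ) 1, ∑ i, pd i φ x ^ 2 ≤ L * -m := by
  have hc1 : ∀ i, ContDiff ℝ 1 (fun x => (φ x - m) * pd i φ x) := fun i =>
    ((hφ.of_le (by norm_num)).sub contDiff_const).mul (contDiff_pd hφ i)
  have hdiv := integral_sum_pd_eq_zero hc1 fun i x j => by
    simp only [hp x j, hp.pd i x j]
  have hpd : ∀ x, ∑ i, pd i (fun x => (φ x - m) * pd i φ x) x =
      ∑ i, pd i φ x ^ 2 + (φ x - m) * lap φ x := by
    intro x
    rw [lap, Finset.mul_sum, ← Finset.sum_add_distrib]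
    refine Finset.sum_congr rfl fun i _ => ?_
    have h1 : HasFDerivAt (fun x => φ x - m) (fderiv ℝ φ x) x :=
      (hφ.differentiable (by norm_num) x).hasFDerivAt.sub_const m
    have h2 := ((contDiff_pd hφ i).differentiable (by norm_num) x).hasFDerivAt
    rw [_root_.pd, (h1.fun_mul h2).fderiv, pd2, _root_.pd, _root_.pd]
    simp
    ring
  have hcφ := hφ.continuous
  have hcl : Continuous (lap φ) := continuous_finsetSum _ fun i _ => continuous_pd2 hφ i i
  have hcs : Continuous fun x => ∑ i, pd i φ x ^ 2 :=
    continuous_finsetSum _ fun i _ => (contDiff_pd hφ i).continuous.pow 2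
  have hcm : Continuous fun x => (φ x - m) * lap φ x := by fun_prop
  simp only [hpd] at hdiv
  rw [integral_add hcs.integrableOn_Icc hcm.integrableOn_Icc] at hdiv
  have hmono : ∫ x in Icc (0 : Fin n → ℝ) 1, -L * (φ x - m) ≤
      ∫ x in Icc (0 : Fin n → ℝ) 1, (φ x - m) * lap φ x := by
    refine setIntegral_mono ?_ hcm.integrableOn_Icc fun x => ?_
    · exact Continuous.integrableOn_Icc (by fun_prop)
    · nlinarith [hm x, hL x]
  rw [integral_const_mul, integral_sub hcφ.integrableOn_Icc continuous_const.integrableOn_Icc, h0,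
    setIntegral_const, volume_real_unitCube] at hmono
  simp at hmono
  linarith

end Torus


section Poincare

theorem setIntegral_setIntegral_swap {X Y : Type*} [TopologicalSpace X] [TopologicalSpace Y]
    [MeasureSpace X] [MeasureSpace Y] [OpensMeasurableSpace (X × Y)] [T2Space X] [T2Space Y]
    [IsLocallyFiniteMeasure (volume.prod volume : Measure (X × Y))]
    [SFinite (volume : Measure X)] [SFinite (volume : Measure Y)]
    {f : X → Y → ℝ} (hf : Continuous (Function.uncurry f)) {s : Set X} {t : Set Y}
    (hs : IsCompact s) (ht : IsCompact t) :
    ∫ x in s, ∫ y in t, f x y = ∫ y in t, ∫ x in s, f x y := by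
  refine integral_integral_swap ?_
  rw [Measure.prod_restrict]
  exact hf.continuousOn.integrableOn_compact (hs.prod ht)

theorem sq_setIntegral_Icc_le {g : ℝ → ℝ} (hg : Continuous g) :
    (∫ t in Icc (0 : ℝ) 1, g t) ^ 2 ≤ ∫ t in Icc (0 : ℝ) 1, g t ^ 2 := by
  set c := ∫ t in Icc (0 : ℝ) 1, g t with hc
  have h0 : 0 ≤ ∫ t in Icc (0 : ℝ) 1, (g t - c) ^ 2 := integral_nonneg fun t => sq_nonneg _
  have h1 : ∫ t in Icc (0 : ℝ) 1, (g t - c) ^ 2 =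
      ∫ t in Icc (0 : ℝ) 1, (g t ^ 2 - 2 * c * g t + c ^ 2) := by
    congr 1; funext t; ring
  rw [h1, integral_add (Continuous.integrableOn_Icc (by fun_prop))
    (Continuous.integrableOn_Icc (by fun_prop)),
    integral_sub (Continuous.integrableOn_Icc (by fun_prop))
    (Continuous.integrableOn_Icc (by fun_prop)), integral_const_mul, ← hc] at h0
  simp at h0
  nlinarith

variable {n : ℕ} {φ : (Fin n → ℝ) → ℝ}

theorem fderiv_apply_eq_sum (x h : Fin n → ℝ) : fderiv ℝ φ x h = ∑ i, h i * pd i φ x := by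
  conv_lhs => rw [← Finset.univ_sum_single h, map_sum]
  refine Finset.sum_congr rfl fun i _ => ?_
  rw [pd, ← smul_eq_mul, ← map_smul, ← Pi.single_smul, smul_eq_mul, mul_one]

theorem sq_sub_le_integral (hφ : ContDiff ℝ 1 φ) {h : Fin n → ℝ} (hh : h ∈ Icc 0 1)
    (y : Fin n → ℝ) :
    (φ (y + h) - φ y) ^ 2 ≤
      ∫ t in Icc (0 : ℝ) 1, n * ∑ i, pd i φ (y + t • h) ^ 2 := by
  have hcd := hφ.continuous_fderiv (by norm_num)
  have hpc : ∀ i, Continuous (pd i φ) := fun i => hcd.clm_apply continuous_const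
  have hline : ∀ t : ℝ, HasDerivAt (fun t : ℝ => φ (y + t • h)) (fderiv ℝ φ (y + t • h) h) t :=
    fun t => HasFDerivAt.comp_hasDerivAt (l := φ) t
      (hφ.differentiable (by norm_num) (y + t • h)).hasFDerivAt
      (by simpa using ((hasDerivAt_id t).smul_const h).const_add y)
  have hgc : Continuous fun t : ℝ => fderiv ℝ φ (y + t • h) h :=
    (hcd.comp (by fun_prop)).clm_apply continuous_const
  have hftc : ∫ t in Icc (0 : ℝ) 1, fderiv ℝ φ (y + t • h) h = φ (y + h) - φ y := by
    rw [integral_Icc_eq_integral_Ioc, ← intervalIntegral.integral_of_le zero_le_one,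
      intervalIntegral.integral_eq_sub_of_hasDerivAt (fun t _ => hline t)
        (hgc.intervalIntegrable _ _)]
    simp
  rw [← hftc]
  refine (sq_setIntegral_Icc_le hgc).trans
    (setIntegral_mono (hgc.pow 2).integrableOn_Icc
      (Continuous.integrableOn_Icc (by fun_prop)) fun t => ?_)
  simp only [fderiv_apply_eq_sum]
  refine (Finset.sum_mul_sq_le_sq_mul_sq _ _ _).trans ?_
  gcongr
  calc ∑ i, h i ^ 2 ≤ ∑ _i : Fin n, (1 : ℝ) :=
        Finset.sum_le_sum fun i _ => pow_le_one₀ (hh.1 i) (hh.2 i)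
    _ = n := by simp

theorem integral_sq_translate_sub_le (hφ : ContDiff ℝ 1 φ) (hp : PeriodicPi φ)
    {h : Fin n → ℝ} (hh : h ∈ Icc 0 1) :
    ∫ y in Icc (0 : Fin n → ℝ) 1, (φ (y + h) - φ y) ^ 2 ≤
      n * ∫ y in Icc (0 : Fin n → ℝ) 1, ∑ i, pd i φ y ^ 2 := by
  have hpc : ∀ i, Continuous (pd i φ) := fun i =>
    (hφ.continuous_fderiv (by norm_num)).clm_apply continuous_const
  have hφc := hφ.continuous
  have hF : Continuous (Function.uncurry fun (y : Fin n → ℝ) (t : ℝ) =>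
      n * ∑ i, pd i φ (y + t • h) ^ 2) := by
    unfold Function.uncurry; fun_prop
  have hS : PeriodicPi fun y => n * ∑ i, pd i φ y ^ 2 := fun x j => by
    simp only [hp.pd _ x j]
  calc _ ≤ ∫ y in Icc (0 : Fin n → ℝ) 1,
          ∫ t in Icc (0 : ℝ) 1, n * ∑ i, pd i φ (y + t • h) ^ 2 :=
        setIntegral_mono (Continuous.integrableOn_Icc (by fun_prop))
          (continuous_parametric_integral_of_continuous hF isCompact_Icc).integrableOn_Icc
          (sq_sub_le_integral hφ hh)
    _ = ∫ t in Icc (0 : ℝ) 1,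
          ∫ y in Icc (0 : Fin n → ℝ) 1, n * ∑ i, pd i φ (y + t • h) ^ 2 :=
        setIntegral_setIntegral_swap hF isCompact_Icc isCompact_Icc
    _ = ∫ t in Icc (0 : ℝ) 1, ∫ y in Icc (0 : Fin n → ℝ) 1, n * ∑ i, pd i φ y ^ 2 := by
        congr 1; funext t
        exact hS.setIntegral_add_right (t • h)
    _ = _ := by simp [integral_const_mul]

/-- Poincaré inequality on the torus. -/
theorem integral_sq_le_integral_sq_pd (hφ : ContDiff ℝ 1 φ) (hp : PeriodicPi φ)
    (h0 : ∫ x in Icc (0 : Fin n → ℝ) 1, φ x = 0) :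
    2 * ∫ x in Icc (0 : Fin n → ℝ) 1, φ x ^ 2 ≤
      n * ∫ x in Icc (0 : Fin n → ℝ) 1, ∑ i, pd i φ x ^ 2 := by
  set A := ∫ x in Icc (0 : Fin n → ℝ) 1, φ x ^ 2 with hA
  set E := ∫ x in Icc (0 : Fin n → ℝ) 1, ∑ i, pd i φ x ^ 2
  have hφc := hφ.continuous
  have hexp : ∀ h, ∫ y in Icc (0 : Fin n → ℝ) 1, (φ (y + h) - φ y) ^ 2 =
      2 * A - 2 * ∫ y in Icc (0 : Fin n → ℝ) 1, φ (y + h) * φ y := by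
    intro h
    have e : ∀ y, (φ (y + h) - φ y) ^ 2 =
        (φ (y + h) ^ 2 + φ y ^ 2) - 2 * (φ (y + h) * φ y) := fun y => by ring
    simp only [e]
    have hsq : PeriodicPi fun y => φ y ^ 2 := fun x j => by simp only [hp x j]
    rw [integral_sub (Continuous.integrableOn_Icc (by fun_prop))
      (Continuous.integrableOn_Icc (by fun_prop)),
      integral_add (Continuous.integrableOn_Icc (by fun_prop))
      (Continuous.integrableOn_Icc (by fun_prop)), integral_const_mul,
      hsq.setIntegral_add_right h, ← hA]
    ring
  have hF : Continuous (Function.uncurry fun (h y : Fin n → ℝ) => φ (y + h) * φ y) := by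
    unfold Function.uncurry; fun_prop
  have hcorr : ∫ h in Icc (0 : Fin n → ℝ) 1, ∫ y in Icc (0 : Fin n → ℝ) 1, φ (y + h) * φ y = 0 := by
    rw [setIntegral_setIntegral_swap hF isCompact_Icc isCompact_Icc]
    simp only [integral_mul_const]
    have : ∀ y, ∫ h in Icc (0 : Fin n → ℝ) 1, φ (y + h) = 0 := fun y => by
      simp only [add_comm y, hp.setIntegral_add_right y, h0]
    simp [this]
  have hcc := continuous_parametric_integral_of_continuous (μ := volume) hF
    (isCompact_Icc (a := (0 : Fin n → ℝ)) (b := 1))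
  have hint := setIntegral_mono_on (μ := volume) (s := Icc (0 : Fin n → ℝ) 1)
    (f := fun h => 2 * A - 2 * ∫ y in Icc (0 : Fin n → ℝ) 1, φ (y + h) * φ y)
    (g := fun _ => n * E) (Continuous.integrableOn_Icc (by fun_prop))
    continuous_const.integrableOn_Icc measurableSet_Icc
    (fun h hh => (hexp h) ▸ integral_sq_translate_sub_le hφ hp hh)
  rw [integral_sub continuous_const.integrableOn_Icc
    (Continuous.integrableOn_Icc (by fun_prop)), integral_const_mul,
    integral_const_mul, hcorr] at hint
  simpa [volume_real_unitCube] using hint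

end Poincare


section CNorm

variable {n : ℕ} {f : (Fin n → ℝ) → ℝ}

theorem pdI_zero : pdI 0 f = f := by
  simp [pdI]

theorem CNorm_zero_le {C : ℝ} (hC : 0 ≤ C) (h : ∀ x, |f x| ≤ C) : CNorm 0 f ≤ C := by
  refine Real.iSup_le (fun I => Real.iSup_le (fun hI => ?_) hC) hC
  obtain rfl : I = 0 := funext fun i => by
    simpa using Finset.sum_eq_zero_iff.1 (Nat.le_zero.1 hI) i (Finset.mem_univ i)
  exact Real.iSup_le (fun x => by rw [pdI_zero]; exact h x) hC

theorem abs_le_CNorm_zero (hf : PeriodicPi f) (hc : Continuous f) (x : Fin n → ℝ) :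
    |f x| ≤ CNorm 0 f := by
  have hb := hf.bddAbove_abs hc
  have h1 : |f x| ≤ ⨆ y, |f y| := le_ciSup hb x
  have h0 : 0 ≤ ⨆ y, |f y| := (abs_nonneg _).trans h1
  have hbd : BddAbove (range fun I : Fin n → ℕ =>
      ⨆ _ : (∑ i, I i) ≤ 0, ⨆ x : Fin n → ℝ, |pdI I f x|) := by
    refine ⟨⨆ y, |f y|, forall_mem_range.2 fun I => Real.iSup_le (fun hI => ?_) h0⟩
    obtain rfl : I = 0 := funext fun i => by
      simpa using Finset.sum_eq_zero_iff.1 (Nat.le_zero.1 hI) i (Finset.mem_univ i)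
    rw [pdI_zero]
  refine h1.trans ((le_of_eq ?_).trans (le_ciSup hbd 0))
  simp [pdI_zero]

end CNorm

section Equation

theorem volume_mul_sq_le_integral_sq {n : ℕ} {u : (Fin n → ℝ) → ℝ} (hu : ContDiff ℝ 2 u)
    (hp : PeriodicPi u) {η K m : ℝ} (hη : 0 < η) (hη4 : η ≤ 4) (hK0 : 0 < K)
    {x₀ : Fin n → ℝ} (hmin : ∀ x, u x₀ ≤ u x) (hm : 1 ≤ m) (hx₀ : u x₀ ≤ -m)
    (hK : ∀ x, HessGE u η x → ∑ i, (pd2 i i u x + η) ≤ K) :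
    volume.real (Metric.ball (0 : Fin n → ℝ) (η / (4 * (n + 1)))) / (n.factorial * K ^ n) *
      (m / 2) ^ 2 ≤ ∫ x in Icc (0 : Fin n → ℝ) 1, u x ^ 2 := by
  have hx₁ : u x₀ + η / 8 ≤ -(m / 2) := by linarith
  set S : Set (Fin n → ℝ) := {x | x ∈ Metric.closedBall x₀ (1 / 2) ∧ u x ≤ u x₀ + η / 8} with hS
  have hball : Metric.closedBall x₀ (1 / 2) =
      Icc (x₀ - fun _ => 1 / 2) ((x₀ - fun _ => 1 / 2) + 1) := by
    ext x
    rw [Metric.mem_closedBall, dist_pi_le_iff (by norm_num)]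
    simp only [Real.dist_eq, abs_le, mem_Icc, Pi.le_def, Pi.sub_apply, Pi.add_apply, Pi.one_apply,
      ← forall_and]
    refine forall_congr' fun i => and_congr ?_ ?_ <;> constructor <;> intro h <;> linarith
  have hSm : MeasurableSet S :=
    (Metric.isClosed_closedBall.inter (isClosed_le hu.continuous continuous_const)).measurableSet
  have hfin : volume S ≠ ⊤ :=
    measure_ne_top_of_subset (fun x hx => hx.1) measure_closedBall_lt_top.ne
  have hvol : volume.real (Metric.ball (0 : Fin n → ℝ) (η / (4 * (n + 1)))) ≤
      n.factorial * K ^ n * volume.real S := by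
    have := ENNReal.toReal_mono (ENNReal.mul_ne_top ENNReal.ofReal_ne_top hfin)
      (volume_ball_le_mul_volume_sublevel hu hη hmin hK)
    rwa [ENNReal.toReal_mul, ENNReal.toReal_ofReal (by positivity)] at this
  have hsq : PeriodicPi fun x => u x ^ 2 := fun x j => by simp only [hp x j]
  have huc := hu.continuous
  have hint : IntegrableOn (fun x => u x ^ 2) (Metric.closedBall x₀ (1 / 2)) :=
    (huc.pow 2).continuousOn.integrableOn_compact (isCompact_closedBall _ _)
  calc _ ≤ volume.real S * (m / 2) ^ 2 := by
        gcongr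
        rw [div_le_iff₀ (by positivity)]
        linarith
    _ = ∫ _ in S, (m / 2) ^ 2 := by rw [setIntegral_const, smul_eq_mul]
    _ ≤ ∫ x in S, u x ^ 2 := by
        refine setIntegral_mono_on (integrableOn_const hfin) (hint.mono_set fun x hx => hx.1) hSm
          fun x hx => ?_
        have := hx.2.trans hx₁
        nlinarith
    _ ≤ ∫ x in Metric.closedBall x₀ (1 / 2), u x ^ 2 :=
        setIntegral_mono_set hint (ae_of_all _ fun x => sq_nonneg _)
          (LE.le.eventuallyLE fun x hx => hx.1)
    _ = _ := by rw [hball]; exact hsq.setIntegral_Icc_add_one _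

variable {F φ : (Fin 5 → ℝ) → ℝ}

theorem EqStar.sum_diag_le (hE : EqStar F φ) (hφ : ContDiff ℝ 2 φ) {x : Fin 5 → ℝ}
    (H : HessGE φ (1 / 8) x) : ∑ i, (pd2 i i φ x + 1 / 8) ≤ 2 * Real.exp (F x) := by
  have hd := fun i => H.diag_nonneg hφ i
  have h0 := H.sq_le hφ 0 4
  have h1 := H.sq_le hφ 1 4
  have h2 := H.sq_le hφ 2 4
  have h3 := H.sq_le hφ 3 4
  have e := hE x
  simp only [show ((0 : Fin 5) = 4) = False by simp, show ((1 : Fin 5) = 4) = False by simp,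
    show ((2 : Fin 5) = 4) = False by simp, show ((3 : Fin 5) = 4) = False by simp,
    if_false, mul_zero, add_zero] at h0 h1 h2 h3
  rw [Fin.sum_univ_five]
  nlinarith [hd 0, hd 1, hd 2, hd 3, hd 4]

theorem EqStar.neg_two_le_lap (hE : EqStar F φ) (hφ : ContDiff ℝ 2 φ) (hp : PeriodicPi φ)
    (x : Fin 5 → ℝ) : -2 ≤ lap φ x := by
  obtain ⟨x₀, hx₀⟩ := hp.exists_forall_le hφ.continuous
  have hmin : IsLocalMin
      (fun y => φ y + (0 : ℝ) / 2 * ((y - x₀) ⬝ᵥ (y - x₀)) - (0 : Fin 5 → ℝ) ⬝ᵥ (y - x₀)) x₀ := by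
    simp only [zero_div, zero_mul, zero_dotProduct, add_zero, sub_zero]
    exact Filter.Eventually.of_forall hx₀
  have H := (pd_eq_and_hessGE_of_isLocalMin hφ hmin).2
  set B : (Fin 5 → ℝ) → ℝ := fun x => pd2 4 4 φ x + 1 with hB
  have hne : ∀ y, B y ≠ 0 := fun y h => by
    have e := hE y
    rw [show pd2 4 4 φ y + 1 = 0 from h] at e
    nlinarith [Real.exp_pos (F y), sq_nonneg (pd2 0 4 φ y), sq_nonneg (pd2 1 4 φ y),
      sq_nonneg (pd2 2 4 φ y), sq_nonneg (pd2 3 4 φ y)]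
  have hB0 : 0 < B x₀ := by
    have := H.diag_nonneg hφ 4
    simp only [hB]
    linarith
  have hBx : 0 < B x := by
    by_contra! hle
    obtain ⟨y, hy⟩ := mem_range_of_exists_le_of_exists_ge
      ((continuous_pd2 hφ 4 4).add continuous_const) ⟨x, hle⟩ ⟨x₀, hB0.le⟩
    exact hne y hy
  have hA : 0 < pd2 0 0 φ x + pd2 1 1 φ x + pd2 2 2 φ x + pd2 3 3 φ x + 1 := by
    refine pos_of_mul_pos_left ?_ hBx.le
    have e := hE x
    simp only [hB]
    nlinarith [Real.exp_pos (F x), sq_nonneg (pd2 0 4 φ x), sq_nonneg (pd2 1 4 φ x),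
      sq_nonneg (pd2 2 4 φ x), sq_nonneg (pd2 3 4 φ x)]
  rw [lap, Fin.sum_univ_five]
  simp only [hB] at hBx
  linarith

/-- Quantitative form of the `C⁰`-estimate in terms of an upper bound `t` for `F`. -/
theorem EqStar.abs_le (hE : EqStar F φ) (hφ : ContDiff ℝ 2 φ) (hp : PeriodicPi φ)
    (h0 : ∫ x in Icc (0 : Fin 5 → ℝ) 1, φ x = 0) {t c R : ℝ} (ht : ∀ x, F x ≤ t)
    (hc : c = volume.real (Metric.ball (0 : Fin 5 → ℝ) (1 / 8 / (4 * ((5 : ℕ) + 1)))) /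
      ((5 : ℕ).factorial * (2 * Real.exp t + 3) ^ 5))
    (hR : R = 20 / c + 1) (x : Fin 5 → ℝ) : |φ x| ≤ R + 20 * R / c := by
  have hc0 : 0 < c := by
    rw [hc]
    refine div_pos (ENNReal.toReal_pos (Metric.measure_ball_pos _ _ (by norm_num)).ne'
      measure_ball_lt_top.ne) (by positivity)
  have hR1 : 1 ≤ R := by rw [hR]; linarith [div_pos (by norm_num : (0 : ℝ) < 20) hc0]
  have hR0 : 0 ≤ 20 * R / c := by positivity
  obtain ⟨x₀, hx₀⟩ := hp.exists_forall_le hφ.continuous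
  obtain ⟨x₁, hx₁⟩ := hp.neg.exists_forall_le hφ.continuous.neg
  have hlap := hE.neg_two_le_lap hφ hp
  have hL2 : ∫ x in Icc (0 : Fin 5 → ℝ) 1, φ x ^ 2 ≤ 5 * -φ x₀ := by
    have h1 := integral_sq_pd_le hφ hp hx₀ hlap h0
    have h2 := integral_sq_le_integral_sq_pd (hφ.of_le (by norm_num)) hp h0
    push_cast at h2
    linarith
  have hmin : -φ x₀ ≤ R := by
    by_contra! hlt
    have h := volume_mul_sq_le_integral_sq hφ hp (η := 1 / 8) (K := 2 * Real.exp t + 3)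
      (m := -φ x₀) (by norm_num) (by norm_num) (by positivity) hx₀ (by linarith) (by linarith)
      fun x H => (hE.sum_diag_le hφ H).trans
        (by linarith [Real.exp_le_exp.2 (ht x)])
    rw [← hc] at h
    have h3 : c * -φ x₀ ≤ 20 := by
      by_contra! h4
      nlinarith
    rw [← le_div_iff₀' hc0] at h3
    linarith
  have hmax : φ x₁ ≤ R + 20 * R / c := by
    by_contra! hlt
    have h := volume_mul_sq_le_integral_sq hφ.neg hp.neg (η := 1 / 8)
      (K := 2 * Real.exp t + 3) (m := φ x₁) (by norm_num) (by norm_num) (by positivity) hx₁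
      (by linarith) le_rfl fun x _ => by
        have h5 := hlap x
        rw [lap, Fin.sum_univ_five] at h5
        rw [Fin.sum_univ_five]
        simp only [pd2_neg]
        linarith [Real.exp_pos t]
    simp only [neg_sq] at h
    rw [← hc] at h
    have h3 : c * φ x₁ ≤ 20 * R := by nlinarith
    rw [← le_div_iff₀' hc0] at h3
    linarith
  rw [abs_le']
  exact ⟨by linarith [hx₁ x], by linarith [hx₀ x]⟩

end Equation

/-- A priori `C⁰`-estimate for solutions of the quaternionic Monge–Ampère equation on `T⁵`. -/
theorem C0_estimate :
    ∃ C₀ : ℝ → ℝ,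
      ∀ F φ : (Fin 5 → ℝ) → ℝ,
        Continuous F → PeriodicPi F →
        (∫ x in Set.Icc (0 : Fin 5 → ℝ) 1, (Real.exp (F x) - 1) = 0) →
        ContDiff ℝ 2 φ → PeriodicPi φ →
        (∫ x in Set.Icc ((fun _ => -(1/2)) : Fin 5 → ℝ) (fun _ => 1/2), φ x) = 0 →
        EqStar F φ →
        CNorm 0 φ ≤ C₀ (CNorm 0 F) := by
  let c : ℝ → ℝ := fun t =>
    volume.real (Metric.ball (0 : Fin 5 → ℝ) (1 / 8 / (4 * ((5 : ℕ) + 1)))) /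
      ((5 : ℕ).factorial * (2 * Real.exp t + 3) ^ 5)
  let R : ℝ → ℝ := fun t => 20 / c t + 1
  refine ⟨fun t => R t + 20 * R t / c t, fun F φ hF hFp _ hφ hp h0 hE => ?_⟩
  have hhalf : (fun _ => 1 / 2 : Fin 5 → ℝ) = (fun _ => -(1 / 2)) + 1 := by
    funext i; norm_num
  rw [hhalf, hp.setIntegral_Icc_add_one] at h0
  have h := hE.abs_le hφ hp h0
    (fun x => (le_abs_self _).trans (abs_le_CNorm_zero hFp hF x)) (rfl : c (CNorm 0 F) = _) rfl
  exact CNorm_zero_le ((abs_nonneg _).trans (h 0)) h
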